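/- arXiv:2303.17030 — 2 statements merged into one kernel-verified Lean document; each statement's English description precedes it below -/
import Mathlib

section
/- λ_*(p) → 1/2 as p → 0⁺ and λ_*(p) → 0 as p → 1⁻; equivalently, α_*(p) := 1 − λ_*(p) satisfies α_*(p) → 1/2 as p → 0⁺ and α_*(p) → 1 as p → 1⁻. -/
open MeasureTheory Real

/-- The density of the Lévy measure `Λ` of the subordinator in the Lamperti
representation of the tagged fragment of the Brownian excursion fragmentation:
`ρ(x) = 2·exp(x)/√(2π·(exp(x) − 1)³)`. -/
noncomputable def levyDensity (x : ℝ) : ℝ :=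
  2 * Real.exp x / Real.sqrt (2 * Real.pi * (Real.exp x - 1) ^ 3)

/-- The Laplace exponent
`Φ^S_p(q) = ∫₀^∞ (1 − exp(−q·x))·(1_{(0, log 2]}(x) + p·1_{(log 2, ∞)}(x))·ρ(x) dx`. -/
noncomputable def PhiS (p q : ℝ) : ℝ :=
  ∫ x in Set.Ioi (0:ℝ), (1 - Real.exp (-q * x)) *
    ((Set.Ioc (0:ℝ) (Real.log 2)).indicator (fun _ => (1:ℝ)) x
      + p * (Set.Ioi (Real.log 2)).indicator (fun _ => (1:ℝ)) x) * levyDensity x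

open Set Filter

lemma levyDensity_eq {x : ℝ} (hx : 0 < x) :
    levyDensity x = 2 * exp x / (√(2 * π) * ((exp x - 1) * √(exp x - 1))) := by
  have hs : 0 < exp x - 1 := by linarith [add_one_lt_exp hx.ne']
  have h : 2 * π * (exp x - 1) ^ 3 = 2 * π * ((exp x - 1) ^ 2 * (exp x - 1)) := by ring
  rw [levyDensity, h, sqrt_mul (by positivity), sqrt_mul (sq_nonneg (exp x - 1)), sqrt_sq hs.le]

lemma levyDensity_nonneg (x : ℝ) : 0 ≤ levyDensity x := by
  unfold levyDensity; positivity

lemma le_levyDensity {x : ℝ} (hx : 0 < x) (hx2 : x ≤ log 2) :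
    2 / √(2 * π) ≤ levyDensity x := by
  have hs : 0 < exp x - 1 := by linarith [add_one_lt_exp hx.ne']
  have hs1 : exp x - 1 ≤ 1 := by
    linarith [(exp_le_exp.2 hx2).trans_eq (exp_log (by norm_num : (0 : ℝ) < 2))]
  have hsq : √(exp x - 1) ≤ 1 := sqrt_le_one.2 hs1
  have hK : 0 < √(2 * π) := by positivity
  rw [levyDensity_eq hx]
  apply div_le_div₀ (by positivity) (by linarith) (by positivity)
  have : (exp x - 1) * √(exp x - 1) ≤ 1 := mul_le_one₀ hs1 (sqrt_nonneg _) hsq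
  nlinarith

lemma levyDensity_le_exp {x : ℝ} (hx : log 2 < x) :
    levyDensity x ≤ 8 / √(2 * π) * exp (-(x / 2)) := by
  have hx0 : 0 < x := (log_pos (by norm_num)).trans hx
  have he : 2 < exp x := by
    simpa [exp_log] using exp_lt_exp.2 hx
  have hK : 0 < √(2 * π) := by positivity
  have hsq : exp (x / 2) / 2 ≤ √(exp x - 1) := by
    apply le_sqrt_of_sq_le
    rw [div_pow, ← exp_nat_mul]
    have : ((2 : ℕ) : ℝ) * (x / 2) = x := by push_cast; ring
    rw [this]; linarith
  rw [levyDensity_eq hx0]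
  have h1 : exp x / 2 * (exp (x / 2) / 2) ≤ (exp x - 1) * √(exp x - 1) :=
    mul_le_mul (by linarith) hsq (by positivity) (by linarith)
  calc 2 * exp x / (√(2 * π) * ((exp x - 1) * √(exp x - 1)))
      ≤ 2 * exp x / (√(2 * π) * (exp x / 2 * (exp (x / 2) / 2))) := by gcongr
    _ = _ := by rw [exp_neg]; field_simp; norm_num

lemma exp_sub_one_mul_levyDensity_le {l x : ℝ} (hl : l ≤ 1 / 2) (hx : 0 < x) :
    (exp (l * x) - 1) * levyDensity x ≤ 1 / √(2 * π) * (exp x / √(exp x - 1)) := by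
  have hs : 0 < exp x - 1 := by linarith [add_one_lt_exp hx.ne']
  have hK : 0 < √(2 * π) := by positivity
  have hr : 0 < √(exp x - 1) := sqrt_pos.2 hs
  have h1 : exp (l * x) ≤ exp (x / 2) := exp_le_exp.2 (by nlinarith)
  have h2 : exp x = exp (x / 2) ^ 2 := by rw [← exp_nat_mul]; congr 1; push_cast; ring
  have h3 : exp (l * x) - 1 ≤ (exp x - 1) / 2 := by nlinarith [sq_nonneg (exp (x / 2) - 1)]
  calc _ ≤ (exp x - 1) / 2 * levyDensity x :=
        mul_le_mul_of_nonneg_right h3 (levyDensity_nonneg x)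
    _ = _ := by rw [levyDensity_eq hx]; field_simp

lemma integral_exp_div_sqrt_exp_sub_one :
    IntegrableOn (fun x => exp x / √(exp x - 1)) (Ioc 0 (log 2)) ∧
      ∫ x in Ioc 0 (log 2), exp x / √(exp x - 1) = 2 := by
  have h0 : (0 : ℝ) ≤ log 2 := log_nonneg (by norm_num)
  have hc : ContinuousOn (fun x => 2 * √(exp x - 1)) (Icc 0 (log 2)) := by fun_prop
  have hd : ∀ x ∈ Ioo 0 (log 2),
      HasDerivAt (fun x => 2 * √(exp x - 1)) (exp x / √(exp x - 1)) x := by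
    intro x hx
    have hs : 0 < exp x - 1 := by linarith [hx.1, add_one_lt_exp hx.1.ne']
    have := (((hasDerivAt_exp x).sub_const 1).sqrt hs.ne').const_mul 2
    have he : 2 * (exp x / (2 * √(exp x - 1))) = exp x / √(exp x - 1) := by field_simp
    rwa [he] at this
  have hi : IntegrableOn (fun x => exp x / √(exp x - 1)) (Ioc 0 (log 2)) :=
    intervalIntegral.integrableOn_deriv_of_nonneg hc hd (fun x _ => by positivity)
  refine ⟨hi, ?_⟩
  rw [← intervalIntegral.integral_of_le h0,
    intervalIntegral.integral_eq_sub_of_hasDerivAt_of_le h0 hc hd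
      ((intervalIntegrable_iff_integrableOn_Ioc_of_le h0).2 hi), exp_log (by norm_num)]
  norm_num

/-- The integrand of `-PhiS p (-l)`, split at `log 2`. -/
lemma PhiS_neg_split {p l : ℝ} (h : PhiS p (-l) ≠ 0) :
    IntegrableOn (fun x => (exp (l * x) - 1) * levyDensity x) (Ioc 0 (log 2)) ∧
    -PhiS p (-l) = (∫ x in Ioc 0 (log 2), (exp (l * x) - 1) * levyDensity x) +
      ∫ x in Ioi (log 2), p * ((exp (l * x) - 1) * levyDensity x) := by
  have h0 : (0 : ℝ) ≤ log 2 := log_nonneg (by norm_num)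
  have hi := not_imp_comm.1 integral_undef h
  have hu : Ioi (0 : ℝ) = Ioc 0 (log 2) ∪ Ioi (log 2) := (Ioc_union_Ioi_eq_Ioi h0).symm
  have hA := hi.neg.mono_measure (Measure.restrict_mono
    (show Ioc 0 (log 2) ⊆ Ioi 0 from Ioc_subset_Ioi_self) le_rfl)
  have hB := hi.neg.mono_measure (Measure.restrict_mono (Ioi_subset_Ioi h0) le_rfl)
  refine ⟨?_, ?_⟩
  · refine IntegrableOn.congr_fun hA (fun x hx => ?_) measurableSet_Ioc
    simp [indicator, hx.1, hx.2, not_lt.2 hx.2]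
    ring
  · rw [PhiS, ← integral_neg, hu]
    refine (setIntegral_union (by rw [disjoint_left]; exact fun x hx => not_lt.2 hx.2)
      measurableSet_Ioi hA hB).trans ?_
    congr 1
    · refine setIntegral_congr_fun measurableSet_Ioc (fun x hx => ?_)
      simp [indicator, hx.1, hx.2, not_lt.2 hx.2]
      ring
    · refine setIntegral_congr_fun measurableSet_Ioi (fun x hx => ?_)
      have hx' : log 2 < x := hx
      simp [indicator, hx', not_le.2 hx']
      ring

lemma mul_le_neg_PhiS {p l : ℝ} (hp : 0 ≤ p) (hl : 0 ≤ l) (h : PhiS p (-l) ≠ 0) :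
    l / 2 * (2 / √(2 * π)) * (log 2 - 1 / 2) ≤ -PhiS p (-l) := by
  obtain ⟨hi, he⟩ := PhiS_neg_split h
  have h2 := log_two_gt_d9
  have hnn : ∀ x, 0 < x → 0 ≤ (exp (l * x) - 1) * levyDensity x := fun x hx =>
    mul_nonneg (by linarith [add_one_le_exp (l * x), mul_nonneg hl hx.le]) (levyDensity_nonneg x)
  have hsub : Ioc (1 / 2) (log 2) ⊆ Ioc 0 (log 2) := Ioc_subset_Ioc_left (by norm_num)
  have hB : 0 ≤ ∫ x in Ioi (log 2), p * ((exp (l * x) - 1) * levyDensity x) :=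
    setIntegral_nonneg measurableSet_Ioi fun x hx => mul_nonneg hp
      (hnn x (lt_trans (by linarith) hx))
  have hm : ∫ x in Ioc (1 / 2) (log 2), (exp (l * x) - 1) * levyDensity x ≤
      ∫ x in Ioc 0 (log 2), (exp (l * x) - 1) * levyDensity x :=
    setIntegral_mono_set hi
      ((ae_restrict_iff' measurableSet_Ioc).2 (.of_forall fun x hx => hnn x hx.1))
      hsub.eventuallyLE
  have hc : ∫ _ in Ioc (1 / 2) (log 2), l / 2 * (2 / √(2 * π)) ≤
      ∫ x in Ioc (1 / 2) (log 2), (exp (l * x) - 1) * levyDensity x := by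
    refine setIntegral_mono_on (integrableOn_const (by simp)) (hi.mono_set hsub)
      measurableSet_Ioc fun x hx => ?_
    have hx0 : 0 < x := lt_trans (by norm_num) hx.1
    have h3 : l / 2 ≤ exp (l * x) - 1 := by
      nlinarith [add_one_le_exp (l * x), mul_le_mul_of_nonneg_left hx.1.le hl]
    exact mul_le_mul h3 (le_levyDensity hx0 hx.2) (by positivity) (by linarith)
  rw [setIntegral_const, smul_eq_mul, measureReal_def, volume_Ioc,
    ENNReal.toReal_ofReal (by linarith)] at hc
  linarith

lemma neg_PhiS_le {p l : ℝ} (hp : 0 ≤ p) (hl0 : 0 ≤ l) (hl : l < 1 / 2)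
    (h : PhiS p (-l) ≠ 0) :
    -PhiS p (-l) ≤ 1 / √(2 * π) * 2 + p * (8 / √(2 * π)) * (1 / (1 / 2 - l)) := by
  obtain ⟨hi, he⟩ := PhiS_neg_split h
  obtain ⟨gi, ge⟩ := integral_exp_div_sqrt_exp_sub_one
  have h2 : 0 < log 2 := log_pos (by norm_num)
  have hA : ∫ x in Ioc 0 (log 2), (exp (l * x) - 1) * levyDensity x ≤ 1 / √(2 * π) * 2 := by
    have := setIntegral_mono_on hi (gi.const_mul _) measurableSet_Ioc fun x hx =>
      exp_sub_one_mul_levyDensity_le hl.le hx.1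
    rwa [integral_const_mul, ge] at this
  have ha : l - 1 / 2 < 0 := by linarith
  have hB : ∫ x in Ioi (log 2), p * ((exp (l * x) - 1) * levyDensity x) ≤
      p * (8 / √(2 * π)) * ∫ x in Ioi (log 2), exp ((l - 1 / 2) * x) := by
    rw [← integral_const_mul]
    refine integral_mono_of_nonneg ?_ ((integrableOn_exp_mul_Ioi ha _).const_mul _) ?_
    · refine (ae_restrict_iff' measurableSet_Ioi).2 (.of_forall fun x hx => ?_)
      have hx0 : 0 < x := h2.trans hx
      exact mul_nonneg hp (mul_nonneg
        (by linarith [add_one_le_exp (l * x), mul_nonneg hl0 hx0.le]) (levyDensity_nonneg x))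
    · refine (ae_restrict_iff' measurableSet_Ioi).2 (.of_forall fun x hx => ?_)
      show p * ((exp (l * x) - 1) * levyDensity x) ≤ p * (8 / √(2 * π)) * exp ((l - 1 / 2) * x)
      rw [mul_assoc]
      refine mul_le_mul_of_nonneg_left ?_ hp
      calc (exp (l * x) - 1) * levyDensity x
          ≤ exp (l * x) * (8 / √(2 * π) * exp (-(x / 2))) :=
            mul_le_mul (by linarith) (levyDensity_le_exp hx) (levyDensity_nonneg x)
              (exp_pos _).le
        _ = 8 / √(2 * π) * (exp (l * x) * exp (-(x / 2))) := by ring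
        _ = _ := by rw [← exp_add]; congr 2; ring
  have hC : ∫ x in Ioi (log 2), exp ((l - 1 / 2) * x) ≤ 1 / (1 / 2 - l) := by
    rw [integral_exp_mul_Ioi ha, ← neg_div_neg_eq, neg_neg, neg_sub]
    have : exp ((l - 1 / 2) * log 2) ≤ 1 := exp_le_one_iff.2 (by nlinarith)
    have : 0 < 1 / 2 - l := by linarith
    gcongr
  have hD : p * (8 / √(2 * π)) * (∫ x in Ioi (log 2), exp ((l - 1 / 2) * x)) ≤
      p * (8 / √(2 * π)) * (1 / (1 / 2 - l)) :=
    mul_le_mul_of_nonneg_left hC (by positivity)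
  linarith

lemma sqrt_two_div_pi : √(2 / π) = 2 / √(2 * π) := by
  have := pi_pos
  rw [sqrt_eq_iff_mul_self_eq (by positivity) (by positivity), div_mul_div_comm,
    mul_self_sqrt (by positivity)]
  field_simp

theorem stmt_10 (lam : ℝ → ℝ)
    (hlam : ∀ p ∈ Set.Ioo (0:ℝ) 1, lam p ∈ Set.Ioo (0:ℝ) (1/2) ∧
      PhiS p (-(lam p)) = -(2 * (1 - p) * Real.sqrt (2 / Real.pi))) :
    Filter.Tendsto lam (nhdsWithin 0 (Set.Ioo (0:ℝ) 1)) (nhds (1/2)) ∧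
    Filter.Tendsto lam (nhdsWithin 1 (Set.Ioo (0:ℝ) 1)) (nhds 0) := by
  have hK : 0 < 1 / √(2 * π) := by positivity
  have hval : ∀ p ∈ Ioo (0 : ℝ) 1, -PhiS p (-(lam p)) = 4 * (1 - p) * (1 / √(2 * π)) := by
    intro p hp
    rw [(hlam p hp).2, sqrt_two_div_pi]; ring
  have hne : ∀ p ∈ Ioo (0 : ℝ) 1, PhiS p (-(lam p)) ≠ 0 := by
    intro p hp h
    have := hval p hp
    rw [h] at this
    nlinarith [mul_pos (sub_pos.2 hp.2) hK]
  constructor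
  · have hlow : ∀ᶠ p in nhdsWithin 0 (Ioo (0 : ℝ) 1), 1 / 2 - 8 * p ≤ lam p := by
      filter_upwards [self_mem_nhdsWithin,
        mem_nhdsWithin_of_mem_nhds (Iio_mem_nhds (by norm_num : (0 : ℝ) < 1 / 4))] with p hp hp4
      have hp4 : p < 1 / 4 := hp4
      obtain ⟨⟨hl0, hl⟩, -⟩ := hlam p hp
      have h := neg_PhiS_le hp.1.le hl0.le hl (hne p hp)
      rw [hval p hp] at h
      have he : 0 < 1 / 2 - lam p := by linarith
      have h' : 4 * (1 - p) * (1 / √(2 * π)) ≤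
          (2 + 8 * p / (1 / 2 - lam p)) * (1 / √(2 * π)) := h.trans_eq (by ring)
      have h3 := le_of_mul_le_mul_right h' hK
      have h4 : 1 ≤ 8 * p / (1 / 2 - lam p) := by linarith
      rw [le_div_iff₀ he] at h4
      linarith
    refine tendsto_of_tendsto_of_tendsto_of_le_of_le' (g := fun p => 1 / 2 - 8 * p)
      (h := fun _ => 1 / 2) ?_ tendsto_const_nhds hlow ?_
    · have : Continuous fun p : ℝ => 1 / 2 - 8 * p := by fun_prop
      simpa using (this.tendsto 0).mono_left nhdsWithin_le_nhds
    · filter_upwards [self_mem_nhdsWithin] with p hp using (hlam p hp).1.2.le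
  · refine tendsto_of_tendsto_of_tendsto_of_le_of_le' (g := fun _ => 0)
      (h := fun p => 40 * (1 - p)) tendsto_const_nhds ?_ ?_ ?_
    · have : Continuous fun p : ℝ => 40 * (1 - p) := by fun_prop
      simpa using (this.tendsto 1).mono_left nhdsWithin_le_nhds
    · filter_upwards [self_mem_nhdsWithin] with p hp using (hlam p hp).1.1.le
    · filter_upwards [self_mem_nhdsWithin] with p hp
      obtain ⟨⟨hl0, hl⟩, -⟩ := hlam p hp
      have h := mul_le_neg_PhiS hp.1.le hl0.le (hne p hp)
      rw [hval p hp] at h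
      have h' : lam p * (log 2 - 1 / 2) * (1 / √(2 * π)) ≤ 4 * (1 - p) * (1 / √(2 * π)) :=
        le_trans (le_of_eq (by ring)) h
      have h3 := le_of_mul_le_mul_right h' hK
      nlinarith [log_two_gt_d9]
end

section
/- For every p ∈ (0,1), the supremum defining λ^*(p) is attained: there exist β ∈ (0, log 2) and δ > 0 such that λ^*(p) = min{ βδ , sup_{γ < 0} ( γδ + κ*_{γ, exp(−β)}(p) ) }. -/
open MeasureTheory Real

/-- The Laplace exponent `Φ(q) = ∫₀^∞ (1 − exp(−q·x))·ρ(x) dx`. -/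
noncomputable def Phi (q : ℝ) : ℝ :=
  ∫ x in Set.Ioi (0:ℝ), (1 - Real.exp (-q * x)) * levyDensity x

open Set

lemma levyDensity_pos {x : ℝ} (hx : 0 < x) : 0 < levyDensity x := by
  have h : 0 < Real.exp x - 1 := by linarith [Real.add_one_lt_exp hx.ne']
  unfold levyDensity
  positivity

lemma measurable_levyDensity : Measurable levyDensity := by
  unfold levyDensity
  fun_prop

lemma integrableOn_of_Phi_ne_zero {q : ℝ} (h : Phi q ≠ 0) :
    IntegrableOn (fun x => (1 - Real.exp (-q * x)) * levyDensity x) (Ioi 0) := by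
  by_contra hn
  exact h (integral_undef hn)

lemma integrableOn_mul_levyDensity {q : ℝ} (hq : q < 0) (h : Phi q ≠ 0) :
    IntegrableOn (fun x => x * levyDensity x) (Ioi 0) := by
  refine Integrable.mono' ((integrableOn_of_Phi_ne_zero h).mul_const q⁻¹)
    (measurable_id.mul measurable_levyDensity).aestronglyMeasurable ?_
  refine (ae_restrict_iff' measurableSet_Ioi).2 (Filter.Eventually.of_forall fun x hx => ?_)
  have hx : 0 < x := hx
  have hρ := levyDensity_pos hx
  rw [Real.norm_of_nonneg (by positivity), mul_right_comm]
  refine mul_le_mul_of_nonneg_right ?_ hρ.le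
  rw [← div_eq_mul_inv, le_div_iff_of_neg hq]
  nlinarith [Real.add_one_le_exp (-q * x)]

lemma integral_mul_levyDensity_pos
    (h : IntegrableOn (fun x => x * levyDensity x) (Ioi 0)) :
    0 < ∫ x in Ioi (0 : ℝ), x * levyDensity x := by
  rw [setIntegral_pos_iff_support_of_nonneg_ae _ h]
  · have hs : Ioi (0 : ℝ) ⊆ Function.support fun x => x * levyDensity x := fun x hx =>
      (mul_pos hx (levyDensity_pos hx)).ne'
    rw [inter_eq_right.2 hs]
    simp
  · exact (ae_restrict_iff' measurableSet_Ioi).2 (Filter.Eventually.of_forall fun x hx =>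
      (mul_pos hx (levyDensity_pos hx)).le)

/-- Lower Lipschitz bound for the Laplace exponent at negative arguments. -/
lemma mul_sub_le_Phi_sub_Phi {a b : ℝ} (ha : 0 ≤ a) (hab : a ≤ b)
    (hia : IntegrableOn (fun x => (1 - Real.exp (-(-a) * x)) * levyDensity x) (Ioi 0))
    (hib : IntegrableOn (fun x => (1 - Real.exp (-(-b) * x)) * levyDensity x) (Ioi 0))
    (hi : IntegrableOn (fun x => x * levyDensity x) (Ioi 0)) :
    (b - a) * (∫ x in Ioi (0 : ℝ), x * levyDensity x) ≤ Phi (-a) - Phi (-b) := by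
  unfold Phi
  rw [← integral_sub hia hib, ← integral_const_mul]
  refine setIntegral_mono_on (hi.const_mul _) (hia.sub hib) measurableSet_Ioi fun x hx => ?_
  have hx : 0 < x := hx
  rw [← sub_mul, ← mul_assoc]
  refine mul_le_mul_of_nonneg_right ?_ (levyDensity_pos hx).le
  have hexp : Real.exp (b * x) = Real.exp (a * x) * Real.exp ((b - a) * x) := by
    rw [← Real.exp_add]; ring_nf
  have h1 : 1 ≤ Real.exp (a * x) := Real.one_le_exp (by positivity)
  have h2 := Real.add_one_le_exp ((b - a) * x)
  have h3 : 0 ≤ (b - a) * x := mul_nonneg (by linarith) hx.le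
  simp only [neg_neg]
  nlinarith

lemma Phi_neg_zero : Phi (-0) = 0 := by
  simp [Phi]

/-- The factor of the equation for `κ*` that depends on the ratio `r = exp (-β)`. -/
noncomputable def ratioFactor (β : ℝ) : ℝ :=
  (2 * Real.exp (-β) - 1) / Real.sqrt (Real.exp (-β) * (1 - Real.exp (-β)))

lemma exp_neg_mem_Ioo {β : ℝ} (hβ : β ∈ Ioo (0 : ℝ) (Real.log 2)) :
    Real.exp (-β) ∈ Ioo (1 / 2 : ℝ) 1 := by
  refine ⟨?_, by simpa using hβ.1⟩
  have h := Real.exp_lt_exp.2 (neg_lt_neg hβ.2)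
  rwa [Real.exp_neg (Real.log 2), Real.exp_log two_pos, inv_eq_one_div] at h

lemma ratioFactor_pos {β : ℝ} (hβ : β ∈ Ioo (0 : ℝ) (Real.log 2)) : 0 < ratioFactor β := by
  obtain ⟨h1, h2⟩ := exp_neg_mem_Ioo hβ
  exact div_pos (by linarith) (Real.sqrt_pos.2 (mul_pos (by linarith) (by linarith)))

lemma ratioFactor_mul_sqrt_le {β : ℝ} (hβ : β ∈ Ioo (0 : ℝ) (Real.log 2)) :
    ratioFactor β * Real.sqrt β ≤ 2 * (2 * Real.exp (-β) - 1) := by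
  obtain ⟨h1, h2⟩ := exp_neg_mem_Ioo hβ
  have hpos : 0 < Real.exp (-β) * (1 - Real.exp (-β)) := mul_pos (by linarith) (by linarith)
  have hb : β * Real.exp (-β) ≤ 1 - Real.exp (-β) := by
    have h := Real.add_one_le_exp β
    have h' : Real.exp β * Real.exp (-β) = 1 := by rw [← Real.exp_add]; simp
    nlinarith
  have hq : Real.sqrt β ≤ 2 * Real.sqrt (Real.exp (-β) * (1 - Real.exp (-β))) := by
    rw [Real.sqrt_le_left (by positivity), mul_pow, Real.sq_sqrt hpos.le]
    have h3 := mul_le_mul_of_nonneg_left hb (Real.exp_pos (-β)).le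
    nlinarith [mul_pos hβ.1 (sub_pos.2 h1), hβ.1]
  rw [ratioFactor, div_mul_eq_mul_div, div_le_iff₀ (Real.sqrt_pos.2 hpos)]
  nlinarith

lemma continuousOn_ratioFactor : ContinuousOn ratioFactor (Ioo (0 : ℝ) (Real.log 2)) := by
  unfold ratioFactor
  refine ContinuousOn.div (by fun_prop) (by fun_prop) fun β hβ => ?_
  obtain ⟨h1, h2⟩ := exp_neg_mem_Ioo hβ
  exact (Real.sqrt_pos.2 (mul_pos (by linarith) (by linarith))).ne'

/-- The supremum over `γ < 0` of `γ δ + k γ β`. -/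
noncomputable def supGamma (k : ℝ → ℝ → ℝ) (β δ : ℝ) : ℝ :=
  sSup { y : ℝ | ∃ γ < (0 : ℝ), y = γ * δ + k γ β }

section Optimization

variable {k : ℝ → ℝ → ℝ} {M : ℝ}

lemma le_supGamma {β δ γ : ℝ} (hk : ∀ γ < (0 : ℝ), k γ β < 1 / 2) (hδ : 0 < δ) (hγ : γ < 0) :
    γ * δ + k γ β ≤ supGamma k β δ := by
  refine le_csSup ⟨1 / 2, ?_⟩ ⟨γ, hγ, rfl⟩
  rintro _ ⟨γ, hγ, rfl⟩
  nlinarith [hk γ hγ]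

lemma supGamma_le {β δ C : ℝ} (h : ∀ γ < (0 : ℝ), γ * δ + k γ β ≤ C) : supGamma k β δ ≤ C := by
  refine csSup_le ⟨_, -1, by norm_num, rfl⟩ ?_
  rintro _ ⟨γ, hγ, rfl⟩
  exact h γ hγ

lemma supGamma_nonneg {β δ : ℝ} (hk : ∀ γ < (0 : ℝ), k γ β ∈ Ioo (0 : ℝ) (1 / 2)) (hδ : 0 < δ) :
    0 ≤ supGamma k β δ := by
  refine le_of_forall_pos_le_add fun ε hε => ?_
  have hγ : -(ε / δ) < 0 := neg_lt_zero.2 (div_pos hε hδ)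
  have h := le_supGamma (fun γ hγ => (hk γ hγ).2) hδ hγ
  have h2 : -(ε / δ) * δ = -ε := by field_simp
  linarith [(hk _ hγ).1]

lemma supGamma_le_add {β β' δ δ' D : ℝ} (hk : ∀ γ < (0 : ℝ), k γ β ∈ Ioo (0 : ℝ) (1 / 2))
    (hk' : ∀ γ < (0 : ℝ), k γ β' ∈ Ioo (0 : ℝ) (1 / 2)) (hδ : 0 < δ) (hδ' : 0 < δ')
    (hD0 : 0 ≤ D) (hD : ∀ γ < (0 : ℝ), k γ β' ≤ k γ β + D) :
    supGamma k β' δ' ≤ supGamma k β δ + (D + |δ' - δ| / (2 * δ')) := by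
  have hq : 0 ≤ |δ' - δ| / (2 * δ') := by positivity
  refine supGamma_le fun γ hγ => ?_
  by_cases h : γ * δ' + 1 / 2 ≤ 0
  · linarith [(hk' γ hγ).2, supGamma_nonneg hk hδ]
  · have h1 := le_supGamma (fun γ hγ => (hk γ hγ).2) hδ hγ
    have h2 : γ * δ' - γ * δ ≤ |δ' - δ| / (2 * δ') := by
      rw [le_div_iff₀ (by positivity)]
      have h3 := neg_abs_le (δ' - δ)
      have h4 := abs_nonneg (δ' - δ)
      have h5 : γ * (δ' - δ) ≤ -γ * |δ' - δ| := by nlinarith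
      nlinarith [mul_le_mul_of_nonneg_right h5 hδ'.le]
    linarith [hD γ hγ]

lemma continuousOn_supGamma
    (hk : ∀ γ < (0 : ℝ), ∀ β ∈ Ioo (0 : ℝ) (Real.log 2), k γ β ∈ Ioo (0 : ℝ) (1 / 2))
    (hM : 0 ≤ M)
    (hL : ∀ γ < (0 : ℝ), ∀ β ∈ Ioo (0 : ℝ) (Real.log 2), ∀ β' ∈ Ioo (0 : ℝ) (Real.log 2),
      k γ β' ≤ k γ β + M * |ratioFactor β' - ratioFactor β|) :
    ContinuousOn (fun z : ℝ × ℝ => supGamma k z.1 z.2)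
      (Ioo (0 : ℝ) (Real.log 2) ×ˢ Ioi (0 : ℝ)) := by
  rintro ⟨β, δ⟩ ⟨hβ, hδ⟩
  have hδ : 0 < δ := hδ
  set s := Ioo (0 : ℝ) (Real.log 2) ×ˢ Ioi (0 : ℝ)
  have hc : ContinuousWithinAt (fun z : ℝ × ℝ => ratioFactor z.1) s (β, δ) :=
    ContinuousWithinAt.comp (x := (β, δ)) (f := Prod.fst) (continuousOn_ratioFactor β hβ)
      continuous_fst.continuousWithinAt fun z hz => hz.1
  have hlow : ContinuousWithinAt (fun z : ℝ × ℝ => supGamma k β δ -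
      (M * |ratioFactor β - ratioFactor z.1| + |δ - z.2| / (2 * δ))) s (β, δ) := by
    refine ContinuousWithinAt.sub continuousWithinAt_const (ContinuousWithinAt.add ?_ ?_)
    · exact continuousWithinAt_const.mul (continuousWithinAt_const.sub hc).abs
    · exact Continuous.continuousWithinAt (by fun_prop)
  have hupp : ContinuousWithinAt (fun z : ℝ × ℝ => supGamma k β δ +
      (M * |ratioFactor z.1 - ratioFactor β| + |z.2 - δ| / (2 * z.2))) s (β, δ) := by
    refine ContinuousWithinAt.add continuousWithinAt_const (ContinuousWithinAt.add ?_ ?_)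
    · exact continuousWithinAt_const.mul (hc.sub continuousWithinAt_const).abs
    · exact ContinuousWithinAt.div (Continuous.continuousWithinAt (by fun_prop))
        (Continuous.continuousWithinAt (by fun_prop)) (by positivity)
  have hlow' := hlow.tendsto
  have hupp' := hupp.tendsto
  simp only [sub_self, abs_zero, mul_zero, zero_div, add_zero, sub_zero] at hlow' hupp'
  refine tendsto_of_tendsto_of_tendsto_of_le_of_le' hlow' hupp' ?_ ?_
  · filter_upwards [self_mem_nhdsWithin] with z hz
    rw [sub_le_iff_le_add]
    exact supGamma_le_add (fun γ hγ => hk γ hγ _ hz.1) (fun γ hγ => hk γ hγ _ hβ) hz.2 hδ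
      (by positivity) fun γ hγ => hL γ hγ _ hz.1 _ hβ
  · filter_upwards [self_mem_nhdsWithin] with z hz
    exact supGamma_le_add (fun γ hγ => hk γ hγ _ hβ) (fun γ hγ => hk γ hγ _ hz.1) hδ hz.2
      (by positivity) fun γ hγ => hL γ hγ _ hβ _ hz.1

/-- The superlevel sets of the objective at positive levels lie in a compact box. -/
lemma exists_box (hM : 0 < M)
    (hkM : ∀ γ < (0 : ℝ), ∀ β ∈ Ioo (0 : ℝ) (Real.log 2),
      k γ β ≤ M * (1 - Real.exp γ) * ratioFactor β) {v : ℝ} (hv : 0 < v) :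
    ∃ β₁ > 0, ∃ β₂ < Real.log 2, ∃ δ₁ > 0, ∃ δ₂, ∀ β ∈ Ioo (0 : ℝ) (Real.log 2), ∀ δ > 0,
      v ≤ min (β * δ) (supGamma k β δ) → β ∈ Icc β₁ β₂ ∧ δ ∈ Icc δ₁ δ₂ := by
  have hlog : 0 < Real.log 2 := Real.log_pos one_lt_two
  set t := v / (2 * M)
  have ht : 0 < t := by positivity
  have htM : v = 2 * M * t := by simp only [t]; field_simp
  refine ⟨t ^ 2, by positivity, -Real.log ((1 + t * t) / 2), ?_, v / Real.log 2,
    by positivity, 2 * M / t, fun β hβ δ hδ hmin => ?_⟩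
  · rw [← Real.log_inv]
    refine Real.log_lt_log (by positivity) ?_
    rw [inv_lt_comm₀ (by positivity) two_pos]
    nlinarith [mul_pos ht ht]
  obtain ⟨h1, h2⟩ := le_min_iff.1 hmin
  obtain ⟨hr1, hr2⟩ := exp_neg_mem_Ioo hβ
  have hg := ratioFactor_pos hβ
  have hgs := ratioFactor_mul_sqrt_le hβ
  have hs : 0 < Real.sqrt β := Real.sqrt_pos.2 hβ.1
  have hss : Real.sqrt β * Real.sqrt β = β := Real.mul_self_sqrt hβ.1.le
  have hδM : δ < M * ratioFactor β := by
    by_contra! hle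
    refine absurd (h2.trans (supGamma_le (C := 0) fun γ hγ => ?_)) (not_le.2 hv)
    have h3 := hkM γ hγ β hβ
    have h4 : M * ratioFactor β * (1 - Real.exp γ) ≤ M * ratioFactor β * (-γ) :=
      mul_le_mul_of_nonneg_left (by linarith [Real.add_one_le_exp γ]) (by positivity)
    nlinarith
  have hvM : v ≤ M * ratioFactor β := h2.trans <| supGamma_le fun γ hγ => by
    have h3 := hkM γ hγ β hβ
    have h4 : M * ratioFactor β * (1 - Real.exp γ) ≤ M * ratioFactor β * 1 :=
      mul_le_mul_of_nonneg_left (by linarith [Real.exp_pos γ]) (by positivity)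
    nlinarith
  have hδs : δ * Real.sqrt β ≤ 2 * M := by nlinarith
  have hts : t ≤ Real.sqrt β := by
    have h3 : v ≤ 2 * M * Real.sqrt β := by
      calc v ≤ δ * Real.sqrt β * Real.sqrt β := by rw [mul_assoc, hss]; linarith
        _ ≤ _ := by gcongr
    rw [htM] at h3
    exact le_of_mul_le_mul_left h3 (by positivity)
  have ht2 : t * t ≤ 2 * Real.exp (-β) - 1 := by
    have h3 : v * t ≤ M * (2 * (2 * Real.exp (-β) - 1)) := by
      calc v * t ≤ M * ratioFactor β * Real.sqrt β := by gcongr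
        _ ≤ _ := by rw [mul_assoc]; gcongr
    rw [htM] at h3
    refine le_of_mul_le_mul_left (a := 2 * M) ?_ (by positivity)
    linarith
  refine ⟨⟨by nlinarith, ?_⟩, ?_, ?_⟩
  · rw [le_neg]
    exact (Real.log_le_iff_le_exp (by positivity)).2 (by linarith)
  · rw [div_le_iff₀ hlog]
    nlinarith [hβ.2]
  · rw [le_div_iff₀ ht]
    nlinarith

theorem exists_isMaxOn_min_supGamma
    (hk : ∀ γ < (0 : ℝ), ∀ β ∈ Ioo (0 : ℝ) (Real.log 2), k γ β ∈ Ioo (0 : ℝ) (1 / 2))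
    (hM : 0 < M)
    (hkM : ∀ γ < (0 : ℝ), ∀ β ∈ Ioo (0 : ℝ) (Real.log 2),
      k γ β ≤ M * (1 - Real.exp γ) * ratioFactor β)
    (hL : ∀ γ < (0 : ℝ), ∀ β ∈ Ioo (0 : ℝ) (Real.log 2), ∀ β' ∈ Ioo (0 : ℝ) (Real.log 2),
      k γ β' ≤ k γ β + M * |ratioFactor β' - ratioFactor β|) :
    ∃ z ∈ Ioo (0 : ℝ) (Real.log 2) ×ˢ Ioi (0 : ℝ),
      IsMaxOn (fun z : ℝ × ℝ => min (z.1 * z.2) (supGamma k z.1 z.2))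
        (Ioo (0 : ℝ) (Real.log 2) ×ˢ Ioi (0 : ℝ)) z := by
  obtain ⟨β₀, hβ₀⟩ := nonempty_Ioo.2 (Real.log_pos one_lt_two)
  have hk₀ := (hk (-1) (by norm_num) β₀ hβ₀).1
  set δ₀ := k (-1) β₀ / 2
  have hδ₀ : 0 < δ₀ := half_pos hk₀
  have hF₀ : 0 < supGamma k β₀ δ₀ := by
    have h := le_supGamma (fun γ hγ => (hk γ hγ β₀ hβ₀).2) hδ₀ (show (-1 : ℝ) < 0 by norm_num)
    have h' : δ₀ = k (-1) β₀ / 2 := rfl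
    linarith
  have hv : 0 < min (β₀ * δ₀) (supGamma k β₀ δ₀) := lt_min (mul_pos hβ₀.1 hδ₀) hF₀
  obtain ⟨β₁, hβ₁, β₂, hβ₂, δ₁, hδ₁, δ₂, hbox⟩ := exists_box hM hkM hv
  have hsub : Icc β₁ β₂ ×ˢ Icc δ₁ δ₂ ⊆ Ioo (0 : ℝ) (Real.log 2) ×ˢ Ioi (0 : ℝ) :=
    prod_mono (Icc_subset_Ioo hβ₁ hβ₂) fun δ hδ => hδ₁.trans_le hδ.1
  have hmem₀ : (β₀, δ₀) ∈ Icc β₁ β₂ ×ˢ Icc δ₁ δ₂ := hbox β₀ hβ₀ δ₀ hδ₀ le_rfl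
  have hcont : ContinuousOn (fun z : ℝ × ℝ => min (z.1 * z.2) (supGamma k z.1 z.2))
      (Icc β₁ β₂ ×ˢ Icc δ₁ δ₂) :=
    ContinuousOn.inf (by fun_prop) ((continuousOn_supGamma hk hM.le hL).mono hsub)
  obtain ⟨z, hz, hmax⟩ := (isCompact_Icc.prod isCompact_Icc).exists_isMaxOn ⟨_, hmem₀⟩ hcont
  refine ⟨z, hsub hz, fun w hw => ?_⟩
  by_cases h : min (β₀ * δ₀) (supGamma k β₀ δ₀) ≤ min (w.1 * w.2) (supGamma k w.1 w.2)
  · exact hmax (show w ∈ _ from hbox w.1 hw.1 w.2 hw.2 h)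
  · exact (not_le.1 h).le.trans (hmax hmem₀)

end Optimization

theorem stmt_16 (p : ℝ) (hp : p ∈ Set.Ioo (0:ℝ) 1) (kappa : ℝ → ℝ → ℝ)
    (hk : ∀ γ < (0:ℝ), ∀ r ∈ Set.Ioo (1/2 : ℝ) 1, kappa γ r ∈ Set.Ioo (0:ℝ) (1/2) ∧
      Phi (-(kappa γ r)) = -(2 * (1 - p) * (1 - Real.exp γ) * Real.sqrt (2 / Real.pi) *
        (2 * r - 1) / Real.sqrt (r * (1 - r)))) :
    ∃ β ∈ Set.Ioo (0:ℝ) (Real.log 2), ∃ δ > (0:ℝ),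
      sSup { x : ℝ | ∃ β' ∈ Set.Ioo (0:ℝ) (Real.log 2), ∃ δ' > (0:ℝ),
          x = min (β' * δ')
            (sSup { y : ℝ | ∃ γ < (0:ℝ), y = γ * δ' + kappa γ (Real.exp (-β')) }) }
        = min (β * δ)
            (sSup { y : ℝ | ∃ γ < (0:ℝ), y = γ * δ + kappa γ (Real.exp (-β)) }) := by
  set k : ℝ → ℝ → ℝ := fun γ β => kappa γ (Real.exp (-β)) with hkdef
  set A : ℝ := 2 * (1 - p) * Real.sqrt (2 / Real.pi) with hA
  set c : ℝ := ∫ x in Ioi (0 : ℝ), x * levyDensity x with hc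
  have hApos : 0 < A := by
    have := sub_pos.2 hp.2
    have := Real.pi_pos
    positivity
  have hexp : ∀ γ < (0 : ℝ), 0 < 1 - Real.exp γ := fun γ hγ => by
    linarith [Real.exp_lt_one_iff.2 hγ]
  have hmem : ∀ γ < (0 : ℝ), ∀ β ∈ Ioo (0 : ℝ) (Real.log 2), k γ β ∈ Ioo (0 : ℝ) (1 / 2) :=
    fun γ hγ β hβ => (hk γ hγ _ (exp_neg_mem_Ioo hβ)).1
  have hPhi : ∀ γ < (0 : ℝ), ∀ β ∈ Ioo (0 : ℝ) (Real.log 2),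
      Phi (-(k γ β)) = -(A * (1 - Real.exp γ) * ratioFactor β) := fun γ hγ β hβ => by
    rw [hkdef, (hk γ hγ _ (exp_neg_mem_Ioo hβ)).2, hA, ratioFactor]
    ring
  have hPhi_ne : ∀ γ < (0 : ℝ), ∀ β ∈ Ioo (0 : ℝ) (Real.log 2), Phi (-(k γ β)) ≠ 0 :=
    fun γ hγ β hβ => by
      rw [hPhi γ hγ β hβ, neg_ne_zero]
      exact (mul_pos (mul_pos hApos (hexp γ hγ)) (ratioFactor_pos hβ)).ne'
  obtain ⟨β₀, hβ₀⟩ := nonempty_Ioo.2 (Real.log_pos one_lt_two)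
  have hi : IntegrableOn (fun x => x * levyDensity x) (Ioi 0) :=
    integrableOn_mul_levyDensity (neg_lt_zero.2 (hmem (-1) (by norm_num) β₀ hβ₀).1)
      (hPhi_ne (-1) (by norm_num) β₀ hβ₀)
  have hcpos : 0 < c := integral_mul_levyDensity_pos hi
  have hM : 0 < A / c := by positivity
  have hkM : ∀ γ < (0 : ℝ), ∀ β ∈ Ioo (0 : ℝ) (Real.log 2),
      k γ β ≤ A / c * (1 - Real.exp γ) * ratioFactor β := fun γ hγ β hβ => by
    have h := mul_sub_le_Phi_sub_Phi le_rfl (hmem γ hγ β hβ).1.le (by simp)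
      (integrableOn_of_Phi_ne_zero (hPhi_ne γ hγ β hβ)) hi
    rw [Phi_neg_zero, hPhi γ hγ β hβ, ← hc] at h
    rw [div_mul_eq_mul_div, div_mul_eq_mul_div, le_div_iff₀ hcpos]
    linarith
  have hL : ∀ γ < (0 : ℝ), ∀ β ∈ Ioo (0 : ℝ) (Real.log 2), ∀ β' ∈ Ioo (0 : ℝ) (Real.log 2),
      k γ β' ≤ k γ β + A / c * |ratioFactor β' - ratioFactor β| := fun γ hγ β hβ β' hβ' => by
    rcases le_total (k γ β') (k γ β) with hle | hle
    · have : 0 ≤ A / c * |ratioFactor β' - ratioFactor β| := by positivity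
      linarith
    have h := mul_sub_le_Phi_sub_Phi (hmem γ hγ β hβ).1.le hle
      (integrableOn_of_Phi_ne_zero (hPhi_ne γ hγ β hβ))
      (integrableOn_of_Phi_ne_zero (hPhi_ne γ hγ β' hβ')) hi
    rw [hPhi γ hγ β hβ, hPhi γ hγ β' hβ', ← hc] at h
    rw [← sub_le_iff_le_add', div_mul_eq_mul_div, le_div_iff₀ hcpos]
    have h1 : A * (1 - Real.exp γ) * (ratioFactor β' - ratioFactor β) ≤
        A * 1 * |ratioFactor β' - ratioFactor β| := by
      refine (mul_le_mul_of_nonneg_left (le_abs_self _)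
        (mul_pos hApos (hexp γ hγ)).le).trans ?_
      gcongr
      linarith [Real.exp_pos γ]
    linarith
  obtain ⟨⟨β, δ⟩, ⟨hβ, hδ⟩, hmax⟩ := exists_isMaxOn_min_supGamma hmem hM hkM hL
  refine ⟨β, hβ, δ, hδ, IsGreatest.csSup_eq ⟨⟨β, hβ, δ, hδ, rfl⟩, ?_⟩⟩
  rintro _ ⟨β', hβ', δ', hδ', rfl⟩
  exact hmax (show (β', δ') ∈ _ from ⟨hβ', hδ'⟩)
end
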